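/- Let 0 < β < α < 1, γ > -β, 1 < m ≤ (γ+1)/(1-β), and b ≥ 0. Then the problem D_0^α y(t) + D_0^β y(t) ≥ t^γ |y(t)|^m for t > 0, with I_0^{1-α} y(t)|_{t=0} = b, has no nontrivial global solution in the space C_{1-α}^α. -/

import Mathlib

open Real MeasureTheory Set Filter Topology

/-- Riemann–Liouville left-sided fractional integral of order `σ` based at `0`. -/
noncomputable def RLI (σ : ℝ) (f : ℝ → ℝ) (t : ℝ) : ℝ :=
  (1 / Real.Gamma σ) * ∫ s in (0 : ℝ)..t, (t - s) ^ (σ - 1) * f s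

/-- Riemann–Liouville fractional derivative of order `σ` based at `0`. -/
noncomputable def RLD (σ : ℝ) (f : ℝ → ℝ) (t : ℝ) : ℝ :=
  deriv (RLI (1 - σ) f) t

/-- Membership in the weighted space `C_{1-α}[0,T]` for every `T > 0`:
`t^{1-α} f(t)` extends continuously to `[0,T]`. -/
def MemCw (α : ℝ) (f : ℝ → ℝ) : Prop :=
  ∀ T > (0 : ℝ), ∃ g : ℝ → ℝ, ContinuousOn g (Set.Icc 0 T) ∧
    ∀ t ∈ Set.Ioc (0 : ℝ) T, g t = t ^ (1 - α) * f t

theorem MemCw.continuousOn {α : ℝ} {f : ℝ → ℝ} (hf : MemCw α f) :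
    ContinuousOn f (Ioi 0) := by
  intro t ht
  have ht' : (0 : ℝ) < t := ht
  obtain ⟨g, hg, hgf⟩ := hf (t + 1) (by positivity)
  have hgc : ContinuousAt g t := hg.continuousAt (Icc_mem_nhds ht' (by linarith))
  have hc : ContinuousAt (fun s => s ^ (α - 1) * g s) t :=
    (continuousAt_id.rpow_const (Or.inl ht'.ne')).mul hgc
  refine (hc.congr ?_).continuousWithinAt
  filter_upwards [Ioo_mem_nhds ht' (by linarith : t < t + 1)] with s hs
  rw [hgf s ⟨hs.1, hs.2.le⟩, ← mul_assoc, ← rpow_add hs.1]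
  simp

theorem MemCw.exists_abs_le {α : ℝ} {f : ℝ → ℝ} (hf : MemCw α f) {T : ℝ} (hT : 0 < T) :
    ∃ C : ℝ, 0 ≤ C ∧ ∀ t ∈ Ioc 0 T, |f t| ≤ C * t ^ (α - 1) := by
  obtain ⟨g, hg, hgf⟩ := hf T hT
  obtain ⟨C, hC⟩ := isCompact_Icc.exists_bound_of_continuousOn hg
  refine ⟨C, (norm_nonneg _).trans (hC 0 ⟨le_rfl, hT.le⟩), fun t ht => ?_⟩
  have h1 := hC t ⟨ht.1.le, ht.2⟩
  rw [hgf t ht, norm_mul, Real.norm_eq_abs, Real.norm_eq_abs,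
    abs_of_nonneg (rpow_nonneg ht.1.le _)] at h1
  have h2 : |f t| = (t ^ (1 - α) * |f t|) * t ^ (α - 1) := by
    rw [mul_right_comm, ← rpow_add ht.1]
    simp
  rw [h2]
  exact mul_le_mul_of_nonneg_right h1 (rpow_nonneg ht.1.le _)

theorem MemCw.intervalIntegrable {α : ℝ} (hα : 0 < α) {f : ℝ → ℝ} (hf : MemCw α f) {T : ℝ}
    (hT : 0 < T) : IntervalIntegrable f volume 0 T := by
  obtain ⟨C, -, hC⟩ := hf.exists_abs_le hT
  have hi : IntervalIntegrable (fun t : ℝ => C * t ^ (α - 1)) volume 0 T :=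
    (intervalIntegral.intervalIntegrable_rpow' (by linarith)).const_mul C
  rw [intervalIntegrable_iff_integrableOn_Ioc_of_le hT.le] at hi ⊢
  refine hi.mono' ((hf.continuousOn.mono Ioc_subset_Ioi_self).aestronglyMeasurable
    measurableSet_Ioc) ?_
  exact (ae_restrict_iff' measurableSet_Ioc).2 (ae_of_all _ fun t ht => hC t ht)

/-- For `0 < σ < 1`, the fractional integral of a function in `C_{1-α}` is `O(t^{α+σ-1})`. -/
theorem MemCw.tendsto_RLI_zero {α σ : ℝ} (hα : 0 < α) (hα1 : α < 1) (hσ : 0 < σ) (hσ1 : σ < 1)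
    (h : 1 < α + σ) {f : ℝ → ℝ} (hf : MemCw α f) :
    Tendsto (RLI σ f) (𝓝[>] 0) (𝓝 0) := by
  obtain ⟨C, hC0, hC⟩ := hf.exists_abs_le one_pos
  set D : ℝ := |1 / Real.Gamma σ| *
    (C * ((1 / 2) ^ (σ - 1) * (1 / α) + (1 / 2) ^ (α - 1) * (1 / σ))) with hD
  have hlim : Tendsto (fun t : ℝ => D * t ^ (α + σ - 1)) (𝓝[>] 0) (𝓝 0) := by
    have h1 : ContinuousAt (fun t : ℝ => D * t ^ (α + σ - 1)) 0 :=
      continuousAt_const.mul (continuousAt_id.rpow_const (Or.inr (by linarith)))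
    have h2 := h1.tendsto
    rw [zero_rpow (by linarith), mul_zero] at h2
    exact h2.mono_left nhdsWithin_le_nhds
  refine squeeze_zero_norm' ?_ hlim
  filter_upwards [Ioo_mem_nhdsGT (one_pos : (0 : ℝ) < 1)] with t ht
  have ht0 := ht.1
  have hi1 : IntervalIntegrable (fun s : ℝ => s ^ (α - 1)) volume 0 t :=
    intervalIntegral.intervalIntegrable_rpow' (by linarith)
  have hi2 : IntervalIntegrable (fun s : ℝ => (t - s) ^ (σ - 1)) volume 0 t := by
    have := (intervalIntegral.intervalIntegrable_rpow' (a := 0) (b := t)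
      (by linarith : -1 < σ - 1)).comp_sub_left t
    simpa using this.symm
  have hbound : ∀ s ∈ Ioc 0 t, ‖(t - s) ^ (σ - 1) * f s‖ ≤
      C * ((t / 2) ^ (σ - 1) * s ^ (α - 1) + (t / 2) ^ (α - 1) * (t - s) ^ (σ - 1)) := by
    intro s hs
    have hts : 0 ≤ t - s := sub_nonneg.2 hs.2
    have p1 : 0 ≤ (t - s) ^ (σ - 1) := rpow_nonneg hts _
    have p2 : 0 ≤ s ^ (α - 1) := rpow_nonneg hs.1.le _
    have p3 : 0 ≤ (t / 2) ^ (σ - 1) := rpow_nonneg (by linarith) _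
    have p4 : 0 ≤ (t / 2) ^ (α - 1) := rpow_nonneg (by linarith) _
    rw [norm_mul, Real.norm_eq_abs, Real.norm_eq_abs, abs_of_nonneg p1]
    have h1 := mul_le_mul_of_nonneg_left (hC s ⟨hs.1, hs.2.trans ht.2.le⟩) p1
    refine h1.trans ?_
    have h2 : (t - s) ^ (σ - 1) * s ^ (α - 1) ≤
        (t / 2) ^ (σ - 1) * s ^ (α - 1) + (t / 2) ^ (α - 1) * (t - s) ^ (σ - 1) := by
      rcases le_total s (t / 2) with h3 | h3
      · have := rpow_le_rpow_of_nonpos (by linarith) (by linarith : t / 2 ≤ t - s)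
          (by linarith : σ - 1 ≤ 0)
        have := mul_le_mul_of_nonneg_right this p2
        have := mul_nonneg p4 p1
        linarith
      · have := rpow_le_rpow_of_nonpos (by linarith) h3 (by linarith : α - 1 ≤ 0)
        have := mul_le_mul_of_nonneg_right this p1
        have := mul_nonneg p3 p2
        linarith
    calc (t - s) ^ (σ - 1) * (C * s ^ (α - 1)) = C * ((t - s) ^ (σ - 1) * s ^ (α - 1)) := by ring
      _ ≤ _ := mul_le_mul_of_nonneg_left h2 hC0
  have hint := intervalIntegral.norm_integral_le_of_norm_le ht0.le (ae_of_all _ hbound)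
    (((hi1.const_mul _).add (hi2.const_mul _)).const_mul _)
  have hval : ∫ s in (0 : ℝ)..t,
      C * ((t / 2) ^ (σ - 1) * s ^ (α - 1) + (t / 2) ^ (α - 1) * (t - s) ^ (σ - 1)) =
      (C * ((1 / 2) ^ (σ - 1) * (1 / α) + (1 / 2) ^ (α - 1) * (1 / σ))) * t ^ (α + σ - 1) := by
    rw [intervalIntegral.integral_const_mul, intervalIntegral.integral_add (hi1.const_mul _)
      (hi2.const_mul _), intervalIntegral.integral_const_mul, intervalIntegral.integral_const_mul,
      intervalIntegral.integral_comp_sub_left (fun s : ℝ => s ^ (σ - 1)) t,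
      integral_rpow (Or.inl (by linarith)), integral_rpow (Or.inl (by linarith))]
    simp only [sub_add_cancel, sub_self, sub_zero]
    rw [zero_rpow hα.ne', zero_rpow hσ.ne', div_eq_mul_one_div t 2,
      mul_rpow ht0.le (by norm_num), mul_rpow ht0.le (by norm_num)]
    have e1 : t ^ (α + σ - 1) = t ^ (σ - 1) * t ^ α := by
      rw [← rpow_add ht0]; congr 1; ring
    have e2 : t ^ (α + σ - 1) = t ^ (α - 1) * t ^ σ := by
      rw [← rpow_add ht0]; congr 1; ring
    rw [mul_assoc C, add_mul]
    congr 2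
    · rw [e1]; ring
    · rw [e2]; ring
  rw [hval] at hint
  rw [RLI, norm_mul, hD, Real.norm_eq_abs, mul_assoc]
  exact mul_le_mul_of_nonneg_left hint (abs_nonneg _)

/-- Tonelli for the kernel `(s - t)^(σ-1)` tested against an antitone weight. -/
theorem lintegral_mul_lintegral_kernel_le {σ T : ℝ} (hσ : 0 < σ) {w f : ℝ → ℝ}
    (hw : AntitoneOn w (Ioc 0 T)) (hw0 : ∀ s ∈ Ioc 0 T, 0 ≤ w s)
    (hwm : Measurable w) (hf : AEMeasurable f (volume.restrict (Ioc 0 T))) :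
    ∫⁻ s in Ioc 0 T, ENNReal.ofReal (w s) *
        ∫⁻ t in Ioc 0 s, ENNReal.ofReal ((s - t) ^ (σ - 1)) * ‖f t‖ₑ ≤
      ∫⁻ t in Ioc 0 T, ‖f t‖ₑ * ENNReal.ofReal (w t * (T ^ σ / σ)) := by
  set k : ℝ → ℝ → ENNReal := fun s t =>
    ENNReal.ofReal (w s) * ((Iic s).indicator (fun t => ENNReal.ofReal ((s - t) ^ (σ - 1))) t
      * ‖f t‖ₑ) with hk
  have hleft : ∀ s ∈ Ioc 0 T, ENNReal.ofReal (w s) *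
      ∫⁻ t in Ioc 0 s, ENNReal.ofReal ((s - t) ^ (σ - 1)) * ‖f t‖ₑ =
      ∫⁻ t in Ioc 0 T, k s t := by
    intro s hs
    rw [hk, lintegral_const_mul' _ _ ENNReal.ofReal_ne_top]
    congr 1
    have : Ioc 0 s = Iic s ∩ Ioc 0 T := by
      ext t; simp only [mem_Ioc, mem_inter_iff, mem_Iic]
      constructor
      · rintro ⟨h1, h2⟩; exact ⟨h2, h1, h2.trans hs.2⟩
      · rintro ⟨h1, h2, _⟩; exact ⟨h2, h1⟩
    rw [this, ← Measure.restrict_restrict measurableSet_Iic,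
      ← lintegral_indicator measurableSet_Iic]
    refine lintegral_congr fun t => ?_
    by_cases ht : t ∈ Iic s
    · simp [ht]
    · simp [ht]
  rw [setLIntegral_congr_fun measurableSet_Ioc hleft]
  have hkm : AEMeasurable (Function.uncurry k)
      ((volume.restrict (Ioc 0 T)).prod (volume.restrict (Ioc 0 T))) := by
    have h1 : Measurable fun q : ℝ × ℝ => ENNReal.ofReal (w q.1) :=
      (hwm.comp measurable_fst).ennreal_ofReal
    have h2 : Measurable fun q : ℝ × ℝ =>
        (Iic q.1).indicator (fun t => ENNReal.ofReal ((q.1 - t) ^ (σ - 1))) q.2 := by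
      have : (fun q : ℝ × ℝ =>
          (Iic q.1).indicator (fun t => ENNReal.ofReal ((q.1 - t) ^ (σ - 1))) q.2) =
          {q : ℝ × ℝ | q.2 ≤ q.1}.indicator
            (fun q => ENNReal.ofReal ((q.1 - q.2) ^ (σ - 1))) := by
        ext q; simp [indicator]
      rw [this]
      refine Measurable.indicator ?_ (measurableSet_le measurable_snd measurable_fst)
      exact ((measurable_fst.sub measurable_snd).pow_const _).ennreal_ofReal
    have h3 : AEMeasurable (fun q : ℝ × ℝ => ‖f q.2‖ₑ)
        ((volume.restrict (Ioc 0 T)).prod (volume.restrict (Ioc 0 T))) :=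
      (hf.comp_snd).enorm
    exact h1.aemeasurable.mul (h2.aemeasurable.mul h3)
  rw [lintegral_lintegral_swap hkm]
  refine setLIntegral_mono_ae' measurableSet_Ioc (ae_of_all _ fun t ht => ?_)
  have hpt : ∀ s ∈ Ioc 0 T, k s t ≤ (‖f t‖ₑ * ENNReal.ofReal (w t)) *
      (Ioc t T).indicator (fun s => ENNReal.ofReal ((s - t) ^ (σ - 1))) s +
      ({t} : Set ℝ).indicator (fun _ => ⊤) s := by
    intro s hs
    rcases lt_trichotomy s t with h | h | h
    · have : t ∉ Iic s := by simpa using h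
      simp [hk, this]
    · simp [h]
    · have h1 : t ∈ Iic s := h.le
      have h2 : s ∈ Ioc t T := ⟨h, hs.2⟩
      simp only [hk, indicator_of_mem h1, indicator_of_mem h2]
      refine le_add_right ?_
      have := ENNReal.ofReal_le_ofReal (hw ht hs h.le)
      calc ENNReal.ofReal (w s) * (ENNReal.ofReal ((s - t) ^ (σ - 1)) * ‖f t‖ₑ)
          = (‖f t‖ₑ * ENNReal.ofReal (w s)) * ENNReal.ofReal ((s - t) ^ (σ - 1)) := by ring
        _ ≤ _ := by gcongr
  refine (setLIntegral_mono_ae' measurableSet_Ioc (ae_of_all _ hpt)).trans ?_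
  rw [lintegral_add_right _ (measurable_const.indicator (measurableSet_singleton t)),
    lintegral_const_mul' _ _ (ENNReal.mul_ne_top enorm_ne_top ENNReal.ofReal_ne_top)]
  have hz : ∫⁻ s in Ioc 0 T, ({t} : Set ℝ).indicator (fun _ => (⊤ : ENNReal)) s = 0 := by
    rw [lintegral_indicator (measurableSet_singleton t)]
    simp
  rw [hz, add_zero, mul_assoc, ENNReal.ofReal_mul (hw0 t ht)]
  gcongr
  calc ∫⁻ s in Ioc 0 T, (Ioc t T).indicator (fun s => ENNReal.ofReal ((s - t) ^ (σ - 1))) s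
      ≤ ∫⁻ s, (Ioc t T).indicator (fun s => ENNReal.ofReal ((s - t) ^ (σ - 1))) s :=
        setLIntegral_le_lintegral _ _
    _ = ∫⁻ s in Ioc t T, ENNReal.ofReal ((s - t) ^ (σ - 1)) :=
        lintegral_indicator measurableSet_Ioc _
    _ = ENNReal.ofReal (∫ s in t..T, (s - t) ^ (σ - 1)) := by
        rw [intervalIntegral.integral_of_le ht.2, ofReal_integral_eq_lintegral_ofReal]
        · rw [← IntegrableOn, ← intervalIntegrable_iff_integrableOn_Ioc_of_le ht.2]
          have := (intervalIntegral.intervalIntegrable_rpow' (a := 0) (b := T - t)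
            (by linarith : -1 < σ - 1)).comp_sub_right t
          simpa using this
        · exact (ae_restrict_iff' measurableSet_Ioc).2
            (ae_of_all _ fun s hs => rpow_nonneg (by linarith [hs.1]) _)
    _ ≤ ENNReal.ofReal (T ^ σ / σ) := by
        refine ENNReal.ofReal_le_ofReal ?_
        rw [intervalIntegral.integral_comp_sub_right (fun s : ℝ => s ^ (σ - 1)) t,
          integral_rpow (Or.inl (by linarith)), sub_self, sub_add_cancel, zero_rpow hσ.ne',
          sub_zero]
        have : (T - t) ^ σ ≤ T ^ σ :=
          rpow_le_rpow (by linarith [ht.2]) (by linarith [ht.1]) hσ.le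
        gcongr

/-- The fractional integral is dominated by the lower Lebesgue integral of its kernel. -/
theorem ofReal_RLI_le {σ s : ℝ} (hσ : 0 < σ) (hs : 0 ≤ s) (f : ℝ → ℝ) :
    ENNReal.ofReal (RLI σ f s) ≤ ENNReal.ofReal (1 / Real.Gamma σ) *
      ∫⁻ t in Ioc 0 s, ENNReal.ofReal ((s - t) ^ (σ - 1)) * ‖f t‖ₑ := by
  have hG : 0 ≤ 1 / Real.Gamma σ := by have := Real.Gamma_pos_of_pos hσ; positivity
  rw [RLI, ENNReal.ofReal_mul hG]
  gcongr
  rw [intervalIntegral.integral_of_le hs]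
  refine (Real.ofReal_le_enorm _).trans ((enorm_integral_le_lintegral_enorm _).trans ?_)
  refine setLIntegral_mono_ae' measurableSet_Ioc (ae_of_all _ fun t ht => ?_)
  rw [enorm_mul, Real.enorm_of_nonneg (rpow_nonneg (by linarith [ht.2]) _)]

/-- The test weight `-(d/ds) (1 - s/T)^p`. -/
noncomputable def cutoffWeight (p T s : ℝ) : ℝ := p / T * (1 - s / T) ^ (p - 1)

theorem cutoffWeight_nonneg {p T s : ℝ} (hp : 1 ≤ p) (hT : 0 < T) (hs : s ≤ T) :
    0 ≤ cutoffWeight p T s := by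
  have : 0 ≤ 1 - s / T := sub_nonneg.2 ((div_le_one hT).2 hs)
  have := rpow_nonneg this (p - 1)
  unfold cutoffWeight
  positivity

theorem continuous_one_sub_div_rpow {T r : ℝ} (hr : 0 ≤ r) :
    Continuous fun s : ℝ => (1 - s / T) ^ r :=
  (continuous_const.sub (continuous_id.div_const T)).rpow_const fun _ => Or.inr hr

theorem continuous_cutoffWeight {p T : ℝ} (hp : 1 ≤ p) : Continuous (cutoffWeight p T) :=
  continuous_const.mul (continuous_one_sub_div_rpow (by linarith))

theorem antitoneOn_cutoffWeight {p T : ℝ} (hp : 1 ≤ p) (hT : 0 < T) :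
    AntitoneOn (cutoffWeight p T) (Ioc 0 T) := by
  intro s _ t ht hst
  have h1 : 0 ≤ 1 - t / T := sub_nonneg.2 ((div_le_one hT).2 ht.2)
  have h2 : (1 - t / T) ^ (p - 1) ≤ (1 - s / T) ^ (p - 1) :=
    rpow_le_rpow h1 (by gcongr) (by linarith)
  unfold cutoffWeight
  gcongr

theorem lintegral_cutoffWeight_mul_RLI_le {σ p T : ℝ} (hσ : 0 < σ) (hp : 1 ≤ p) (hT : 0 < T)
    {f : ℝ → ℝ} (hf : IntervalIntegrable f volume 0 T) :
    ∫⁻ s in Ioc 0 T, ENNReal.ofReal (cutoffWeight p T s) * ENNReal.ofReal (RLI σ f s) ≤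
      ENNReal.ofReal (p / (Real.Gamma σ * σ) * T ^ (σ - 1) *
        ∫ t in (0 : ℝ)..T, |f t| * (1 - t / T) ^ (p - 1)) := by
  have hG := Real.Gamma_pos_of_pos hσ
  have hfi : IntegrableOn f (Ioc 0 T) :=
    (intervalIntegrable_iff_integrableOn_Ioc_of_le hT.le).1 hf
  have hi : IntervalIntegrable (fun t => |f t| * (1 - t / T) ^ (p - 1)) volume 0 T :=
    hf.abs.mul_continuousOn (continuous_one_sub_div_rpow (by linarith)).continuousOn
  calc ∫⁻ s in Ioc 0 T, ENNReal.ofReal (cutoffWeight p T s) * ENNReal.ofReal (RLI σ f s)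
      ≤ ∫⁻ s in Ioc 0 T, ENNReal.ofReal (1 / Real.Gamma σ) *
          (ENNReal.ofReal (cutoffWeight p T s) *
            ∫⁻ t in Ioc 0 s, ENNReal.ofReal ((s - t) ^ (σ - 1)) * ‖f t‖ₑ) := by
        refine setLIntegral_mono_ae' measurableSet_Ioc (ae_of_all _ fun s hs => ?_)
        rw [mul_left_comm]
        gcongr
        exact ofReal_RLI_le hσ hs.1.le f
    _ ≤ ENNReal.ofReal (1 / Real.Gamma σ) *
          ∫⁻ t in Ioc 0 T, ‖f t‖ₑ * ENNReal.ofReal (cutoffWeight p T t * (T ^ σ / σ)) := by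
        rw [lintegral_const_mul' _ _ ENNReal.ofReal_ne_top]
        refine mul_le_mul' le_rfl ?_
        exact lintegral_mul_lintegral_kernel_le hσ (antitoneOn_cutoffWeight hp hT)
          (fun s hs => cutoffWeight_nonneg hp hT hs.2) (continuous_cutoffWeight hp).measurable
          hfi.aestronglyMeasurable.aemeasurable
    _ = ENNReal.ofReal (1 / Real.Gamma σ) * ∫⁻ t in Ioc 0 T,
          ENNReal.ofReal (p / σ * T ^ (σ - 1) * (|f t| * (1 - t / T) ^ (p - 1))) := by
        congr 1
        refine setLIntegral_congr_fun measurableSet_Ioc fun t ht => ?_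
        rw [← ofReal_norm, ← ENNReal.ofReal_mul (norm_nonneg _), Real.norm_eq_abs,
          cutoffWeight, rpow_sub_one hT.ne']
        congr 1
        ring
    _ = _ := by
        rw [← ofReal_integral_eq_lintegral_ofReal, ← ENNReal.ofReal_mul (by positivity),
          intervalIntegral.integral_of_le hT.le, integral_const_mul]
        · congr 1
          field_simp
        · exact ((intervalIntegrable_iff_integrableOn_Ioc_of_le hT.le).1 hi).const_mul _
        · refine (ae_restrict_iff' measurableSet_Ioc).2 (ae_of_all _ fun t ht => ?_)
          have h1 : 0 ≤ 1 - t / T := sub_nonneg.2 ((div_le_one hT).2 ht.2)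
          have h2 := rpow_nonneg h1 (p - 1)
          have h3 : 0 < T ^ (σ - 1) := rpow_pos_of_pos hT _
          show 0 ≤ p / σ * T ^ (σ - 1) * (|f t| * (1 - t / T) ^ (p - 1))
          positivity

theorem integral_cutoffWeight_mul_primitive {p a T δ : ℝ} (hp : 1 ≤ p) (ha : 0 < a) (haT : a ≤ T)
    {h : ℝ → ℝ} (hh : ContinuousOn h (Ioi 0)) :
    ∫ s in a..T, cutoffWeight p T s * (δ + ∫ t in a..s, h t) =
      δ * (1 - a / T) ^ p + ∫ t in a..T, h t * (1 - t / T) ^ p := by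
  have hT : 0 < T := ha.trans_le haT
  have hsub : ∀ s ∈ uIcc a T, 0 < s := fun s hs => by
    rw [uIcc_of_le haT] at hs; exact ha.trans_le hs.1
  have hu : ∀ s ∈ uIcc a T, HasDerivAt (fun s : ℝ => (1 - s / T) ^ p)
      (-cutoffWeight p T s) s := by
    intro s _
    have h1 : HasDerivAt (fun s : ℝ => 1 - s / T) (-(1 / T)) s := by
      simpa using ((hasDerivAt_id s).div_const T).const_sub 1
    convert h1.rpow_const (p := p) (Or.inr hp) using 1
    rw [cutoffWeight]; ring
  have hv : ∀ s ∈ uIcc a T, HasDerivAt (fun s : ℝ => δ + ∫ t in a..s, h t) (h s) s := by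
    intro s hs
    refine (intervalIntegral.integral_hasDerivAt_right ?_ ?_ ?_).const_add δ
    · exact (hh.mono fun x hx => hsub x (uIcc_subset_uIcc_left hs hx)).intervalIntegrable
    · exact hh.stronglyMeasurableAtFilter isOpen_Ioi s (hsub s hs)
    · exact hh.continuousAt (Ioi_mem_nhds (hsub s hs))
  have key := intervalIntegral.integral_mul_deriv_eq_deriv_mul hu hv
    ((continuous_cutoffWeight hp).neg.intervalIntegrable _ _) (hh.mono hsub).intervalIntegrable
  simp only [div_self hT.ne', sub_self, zero_rpow (by linarith : p ≠ 0), zero_mul,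
    intervalIntegral.integral_same, add_zero, neg_mul, intervalIntegral.integral_neg] at key
  have hc : ∫ t in a..T, h t * (1 - t / T) ^ p = ∫ t in a..T, (1 - t / T) ^ p * h t := by
    simp only [mul_comm]
  rw [hc, key]
  ring

/-- Testing `I^{1-α} f + I^{1-β} f ≥ δ + ∫_a^s h` against `cutoffWeight`. -/
theorem cutoff_inequality {α β p a T δ : ℝ} (hβα : β ≤ α) (hα1 : α < 1) (hp : 1 ≤ p)
    (ha : 1 ≤ a) (haT : a ≤ T) (hδ : 0 ≤ δ) {f h : ℝ → ℝ}
    (hf : IntervalIntegrable f volume 0 T) (hIf : ContinuousOn (RLI (1 - α) f) (Ioi 0))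
    (hh : ContinuousOn h (Ioi 0))
    (hh0 : ∀ t > 0, 0 ≤ h t)
    (hF : ∀ s, a ≤ s → δ + ∫ t in a..s, h t ≤ RLI (1 - α) f s + RLI (1 - β) f s) :
    δ * (1 - a / T) ^ p + ∫ t in a..T, h t * (1 - t / T) ^ p ≤
      (p / (Real.Gamma (1 - α) * (1 - α)) + p / (Real.Gamma (1 - β) * (1 - β))) * T ^ (-β) *
        ∫ t in (0 : ℝ)..T, |f t| * (1 - t / T) ^ (p - 1) := by
  have ha0 : 0 < a := by linarith
  have hT : 0 < T := by linarith
  have hGα := Real.Gamma_pos_of_pos (by linarith : 0 < 1 - α)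
  have hGβ := Real.Gamma_pos_of_pos (by linarith : 0 < 1 - β)
  have hα' : 0 < 1 - α := by linarith
  have hβ' : 0 < 1 - β := by linarith
  set J := ∫ t in (0 : ℝ)..T, |f t| * (1 - t / T) ^ (p - 1) with hJ
  have hJ0 : 0 ≤ J := intervalIntegral.integral_nonneg hT.le fun t ht =>
    mul_nonneg (abs_nonneg _) (rpow_nonneg (sub_nonneg.2 ((div_le_one hT).2 ht.2)) _)
  have hsub : ∀ s ∈ uIcc a T, 0 < s := fun s hs => by
    rw [uIcc_of_le haT] at hs; exact ha0.trans_le hs.1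
  have hprim0 : ∀ s, a ≤ s → 0 ≤ δ + ∫ t in a..s, h t := fun s hs =>
    add_nonneg hδ (intervalIntegral.integral_nonneg hs fun t ht => hh0 t (ha0.trans_le ht.1))
  have hint : IntervalIntegrable
      (fun s => cutoffWeight p T s * (δ + ∫ t in a..s, h t)) volume a T := by
    refine ContinuousOn.intervalIntegrable ?_
    refine (continuous_cutoffWeight hp).continuousOn.mul (continuousOn_const.add ?_)
    exact intervalIntegral.continuousOn_primitive_interval
      ((hh.mono hsub).integrableOn_compact isCompact_uIcc)
  rw [← integral_cutoffWeight_mul_primitive hp ha0 haT hh]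
  have hup : ∀ σ, 0 < σ → σ - 1 ≤ -β →
      ∫⁻ s in Ioc 0 T, ENNReal.ofReal (cutoffWeight p T s) * ENNReal.ofReal (RLI σ f s) ≤
      ENNReal.ofReal (p / (Real.Gamma σ * σ) * T ^ (-β) * J) := by
    intro σ hσ hσβ
    refine (lintegral_cutoffWeight_mul_RLI_le hσ hp hT hf).trans (ENNReal.ofReal_le_ofReal ?_)
    have hG := Real.Gamma_pos_of_pos hσ
    have : T ^ (σ - 1) ≤ T ^ (-β) := rpow_le_rpow_of_exponent_le (by linarith) hσβ
    gcongr
  have hTβ : 0 < T ^ (-β) := rpow_pos_of_pos hT _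
  rw [← ENNReal.ofReal_le_ofReal_iff (by positivity)]
  calc ENNReal.ofReal (∫ s in a..T, cutoffWeight p T s * (δ + ∫ t in a..s, h t))
      = ∫⁻ s in Ioc a T, ENNReal.ofReal (cutoffWeight p T s * (δ + ∫ t in a..s, h t)) := by
        rw [intervalIntegral.integral_of_le haT, ofReal_integral_eq_lintegral_ofReal
          ((intervalIntegrable_iff_integrableOn_Ioc_of_le haT).1 hint)]
        exact (ae_restrict_iff' measurableSet_Ioc).2 (ae_of_all _ fun s hs =>
          mul_nonneg (cutoffWeight_nonneg hp hT hs.2) (hprim0 s hs.1.le))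
    _ ≤ ∫⁻ s in Ioc a T, (ENNReal.ofReal (cutoffWeight p T s) * ENNReal.ofReal (RLI (1 - α) f s) +
          ENNReal.ofReal (cutoffWeight p T s) * ENNReal.ofReal (RLI (1 - β) f s)) := by
        refine setLIntegral_mono_ae' measurableSet_Ioc (ae_of_all _ fun s hs => ?_)
        rw [ENNReal.ofReal_mul (cutoffWeight_nonneg hp hT hs.2), ← mul_add]
        gcongr
        exact (ENNReal.ofReal_le_ofReal (hF s hs.1.le)).trans ENNReal.ofReal_add_le
    _ ≤ ∫⁻ s in Ioc 0 T, (ENNReal.ofReal (cutoffWeight p T s) * ENNReal.ofReal (RLI (1 - α) f s) +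
          ENNReal.ofReal (cutoffWeight p T s) * ENNReal.ofReal (RLI (1 - β) f s)) :=
        lintegral_mono_set (Ioc_subset_Ioc_left ha0.le)
    _ ≤ _ := by
        rw [lintegral_add_left']
        · refine (add_le_add (hup _ hα' (by linarith)) (hup _ hβ' (by linarith))).trans ?_
          rw [← ENNReal.ofReal_add (by positivity) (by positivity), add_mul, add_mul]
        · exact (continuous_cutoffWeight hp).measurable.ennreal_ofReal.aemeasurable.mul
            ((hIf.mono Ioc_subset_Ioi_self).aemeasurable measurableSet_Ioc).ennreal_ofReal

/-- Weighted Young inequality at the critical exponent. -/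
theorem critical_young {β m p B C t x : ℝ} (hpm : m.HolderConjugate p) (hB : 0 < B) (hC : 0 ≤ C)
    {T : ℝ} (ht : 0 < t) (htT : t ≤ T) (hx : 0 ≤ x) :
    C * T ^ (-β) * (x * (1 - t / T) ^ (p - 1)) ≤
      B ^ m * (t ^ (m * (1 - β) - 1) * x ^ m * (1 - t / T) ^ p) +
        (C / B) ^ p * T ^ (-(β * p)) * t ^ (β * p - 1) := by
  have hT : 0 < T := ht.trans_le htT
  have hz : 0 ≤ 1 - t / T := sub_nonneg.2 ((div_le_one hT).2 htT)
  have hm0 := hpm.pos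
  have hp0 := hpm.symm.pos
  have hm1 := hpm.lt
  have hp1 := hpm.symm.lt
  set z := 1 - t / T with hzdef
  set e := 1 / p - β with he
  have hzp := rpow_nonneg hz (p - 1)
  have hte := rpow_pos_of_pos ht e
  have hte' := rpow_pos_of_pos ht (-e)
  have hTβ := rpow_pos_of_pos hT (-β)
  have hyoung := Real.young_inequality_of_nonneg
    (a := B * (t ^ e * x * z ^ (p - 1))) (b := C / B * (T ^ (-β) * t ^ (-e)))
    (by positivity) (by positivity) hpm
  have hinv : 1 / p = 1 - 1 / m := by
    have := hpm.inv_add_inv_eq_one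
    rw [one_div, one_div]; linarith
  have hmul := hpm.mul_eq_add
  have e1 : B * (t ^ e * x * z ^ (p - 1)) * (C / B * (T ^ (-β) * t ^ (-e))) =
      C * T ^ (-β) * (x * z ^ (p - 1)) := by
    have : t ^ e * t ^ (-e) = 1 := by rw [← rpow_add ht]; simp
    calc _ = (B / B) * C * T ^ (-β) * (x * z ^ (p - 1)) * (t ^ e * t ^ (-e)) := by ring
      _ = _ := by rw [this, div_self hB.ne']; ring
  have e2 : (B * (t ^ e * x * z ^ (p - 1))) ^ m =
      B ^ m * (t ^ (m * (1 - β) - 1) * x ^ m * z ^ p) := by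
    rw [mul_rpow hB.le (by positivity), mul_rpow (by positivity) hzp, mul_rpow hte.le hx,
      ← rpow_mul ht.le, ← rpow_mul hz]
    congr 4
    · rw [he, hinv]; field_simp; ring
    · linarith
  have e3 : (C / B * (T ^ (-β) * t ^ (-e))) ^ p =
      (C / B) ^ p * T ^ (-(β * p)) * t ^ (β * p - 1) := by
    rw [mul_rpow (by positivity) (by positivity), mul_rpow hTβ.le hte'.le,
      ← rpow_mul hT.le, ← rpow_mul ht.le, mul_assoc]
    congr 3
    · ring
    · rw [he]; field_simp; ring
  have n2 : 0 ≤ (B * (t ^ e * x * z ^ (p - 1))) ^ m := by positivity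
  have n3 : 0 ≤ (C / B * (T ^ (-β) * t ^ (-e))) ^ p := by positivity
  have := div_le_self n2 hm1.le
  have := div_le_self n3 hp1.le
  rw [e1] at hyoung
  rw [← e2, ← e3]
  linarith

/-- The tested integral splits at `R`: Young's inequality absorbs the part beyond `R`. -/
theorem critical_split {β m p B C R T : ℝ} (hpm : m.HolderConjugate p) (hβ : 0 < β) (hB : 0 < B)
    (hC : 0 ≤ C) (hR : 0 < R) (hRT : R ≤ T) {f : ℝ → ℝ} (hfc : ContinuousOn f (Ioi 0))
    (hfi : IntervalIntegrable f volume 0 T) :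
    C * T ^ (-β) * ∫ t in (0 : ℝ)..T, |f t| * (1 - t / T) ^ (p - 1) ≤
      C * T ^ (-β) * (∫ t in (0 : ℝ)..R, |f t|) +
        B ^ m * (∫ t in R..T, t ^ (m * (1 - β) - 1) * |f t| ^ m * (1 - t / T) ^ p) +
        (C / B) ^ p / (β * p) := by
  have hT : 0 < T := hR.trans_le hRT
  have hm0 := hpm.pos
  have hp0 := hpm.symm.pos
  have hp1 := hpm.symm.lt
  have hTβ := rpow_pos_of_pos hT (-β)
  have hβp : 0 < β * p := by positivity
  have hcφ : Continuous fun t : ℝ => (1 - t / T) ^ (p - 1) :=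
    continuous_one_sub_div_rpow (by linarith)
  have hi : IntervalIntegrable (fun t => |f t| * (1 - t / T) ^ (p - 1)) volume 0 T :=
    hfi.abs.mul_continuousOn hcφ.continuousOn
  have hR0 : R ∈ uIcc 0 T := by rw [uIcc_of_le hT.le]; exact ⟨hR.le, hRT⟩
  have hi1 := hi.mono_set (uIcc_subset_uIcc_left hR0)
  have hi2 := hi.mono_set (uIcc_subset_uIcc_right hR0)
  have hfi1 := hfi.mono_set (uIcc_subset_uIcc_left hR0)
  rw [← intervalIntegral.integral_add_adjacent_intervals hi1 hi2, mul_add, add_assoc]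
  refine add_le_add ?_ ?_
  · refine mul_le_mul_of_nonneg_left ?_ (by positivity)
    refine intervalIntegral.integral_mono_on hR.le hi1 hfi1.abs fun t ht => ?_
    have h1 : 0 ≤ 1 - t / T := sub_nonneg.2 ((div_le_one hT).2 (ht.2.trans hRT))
    have h2 : 1 - t / T ≤ 1 := by have := div_nonneg ht.1 hT.le; linarith
    exact mul_le_of_le_one_right (abs_nonneg _) (rpow_le_one h1 h2 (by linarith))
  · have hpos : ∀ t ∈ uIcc R T, 0 < t := fun t ht => by
      rw [uIcc_of_le hRT] at ht; exact hR.trans_le ht.1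
    have hi3 : IntervalIntegrable
        (fun t => t ^ (m * (1 - β) - 1) * |f t| ^ m * (1 - t / T) ^ p) volume R T := by
      refine ContinuousOn.intervalIntegrable (ContinuousOn.mul (ContinuousOn.mul ?_ ?_) ?_)
      · exact continuousOn_id.rpow_const fun t ht => Or.inl (hpos t ht).ne'
      · exact ((hfc.mono hpos).abs).rpow_const fun t _ => Or.inr hm0.le
      · exact (continuous_one_sub_div_rpow hp0.le).continuousOn
    have hi4 : ∀ c d : ℝ, IntervalIntegrable (fun t : ℝ => t ^ (β * p - 1)) volume c d :=
      fun c d => intervalIntegral.intervalIntegrable_rpow' (by linarith)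
    have hmono := intervalIntegral.integral_mono_on hRT (hi2.const_mul (C * T ^ (-β)))
      ((hi3.const_mul (B ^ m)).add ((hi4 R T).const_mul ((C / B) ^ p * T ^ (-(β * p)))))
      fun t ht => critical_young (β := β) hpm hB hC (hR.trans_le ht.1) ht.2 (abs_nonneg (f t))
    rw [intervalIntegral.integral_add (hi3.const_mul _) ((hi4 R T).const_mul _)] at hmono
    simp only [intervalIntegral.integral_const_mul] at hmono
    refine hmono.trans (add_le_add le_rfl ?_)
    have h5 : ∫ t in R..T, t ^ (β * p - 1) ≤ T ^ (β * p) / (β * p) := by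
      rw [integral_rpow (Or.inl (by linarith)), sub_add_cancel]
      have := rpow_nonneg hR.le (β * p)
      gcongr
      linarith
    calc (C / B) ^ p * T ^ (-(β * p)) * ∫ t in R..T, t ^ (β * p - 1)
        ≤ (C / B) ^ p * T ^ (-(β * p)) * (T ^ (β * p) / (β * p)) := by
          gcongr
      _ = (C / B) ^ p / (β * p) * (T ^ (-(β * p)) * T ^ (β * p)) := by ring
      _ = _ := by rw [← rpow_add hT]; simp

/-- The cut-off inequality at the critical exponent is self-contradictory as `T → ∞`. -/
theorem not_cutoff_inequality {β m p C a δ : ℝ} (hpm : m.HolderConjugate p) (hβ : 0 < β)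
    (hC : 0 < C) (ha : 1 ≤ a) (hδ : 0 < δ) {f : ℝ → ℝ} (hfc : ContinuousOn f (Ioi 0))
    (hfi : ∀ T > 0, IntervalIntegrable f volume 0 T)
    (hcut : ∀ T, a ≤ T → δ * (1 - a / T) ^ p +
        ∫ t in a..T, t ^ (m * (1 - β) - 1) * |f t| ^ m * (1 - t / T) ^ p ≤
      C * T ^ (-β) * ∫ t in (0 : ℝ)..T, |f t| * (1 - t / T) ^ (p - 1)) : False := by
  have ha0 : 0 < a := by linarith
  have hm0 := hpm.pos
  have hm1 := hpm.lt
  have hp0 := hpm.symm.pos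
  have hβp : 0 < β * p := by positivity
  set h : ℝ → ℝ := fun t => t ^ (m * (1 - β) - 1) * |f t| ^ m with hh
  have hh0 : ∀ t > 0, 0 ≤ h t := fun t ht =>
    mul_nonneg (rpow_nonneg ht.le _) (rpow_nonneg (abs_nonneg _) _)
  have hhc : ContinuousOn h (Ioi 0) :=
    (continuousOn_id.rpow_const fun t ht => Or.inl (ne_of_gt ht)).mul
      (hfc.abs.rpow_const fun t _ => Or.inr hm0.le)
  have hhi : ∀ c d, 0 < c → c ≤ d → IntervalIntegrable h volume c d := fun c d hc hcd =>
    (hhc.mono fun t ht => by rw [uIcc_of_le hcd] at ht; exact hc.trans_le ht.1).intervalIntegrable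
  have hφc : ∀ T, Continuous fun t : ℝ => (1 - t / T) ^ p := fun T =>
    continuous_one_sub_div_rpow hp0.le
  have hφ : ∀ T : ℝ, 0 < T → ∀ t : ℝ, 0 ≤ t → t ≤ T → 0 ≤ (1 - t / T) ^ p ∧ (1 - t / T) ^ p ≤ 1 := by
    intro T hT t ht htT
    have h1 : 0 ≤ 1 - t / T := sub_nonneg.2 ((div_le_one hT).2 htT)
    have h2 : 1 - t / T ≤ 1 := by have := div_nonneg ht hT.le; linarith
    exact ⟨rpow_nonneg h1 _, rpow_le_one h1 h2 hp0.le⟩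
  have hhφi : ∀ T c d, 0 < c → c ≤ d →
      IntervalIntegrable (fun t => h t * (1 - t / T) ^ p) volume c d := fun T c d hc hcd =>
    (hhi c d hc hcd).mul_continuousOn (hφc T).continuousOn
  have hX0 : ∀ R T, 0 < R → R ≤ T → 0 ≤ ∫ t in R..T, h t * (1 - t / T) ^ p := fun R T hR hRT =>
    intervalIntegral.integral_nonneg hRT fun t ht =>
      mul_nonneg (hh0 t (hR.trans_le ht.1))
        (hφ T (hR.trans_le hRT) t (hR.le.trans ht.1) ht.2).1
  have hI0 : ∀ R, 0 < R → 0 ≤ ∫ t in (0 : ℝ)..R, |f t| := fun R hR =>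
    intervalIntegral.integral_nonneg hR.le fun t _ => abs_nonneg _
  have hsplit : ∀ B R T, 0 < B → a ≤ R → R ≤ T →
      δ * (1 - a / T) ^ p + ∫ t in a..T, h t * (1 - t / T) ^ p ≤
      C * T ^ (-β) * (∫ t in (0 : ℝ)..R, |f t|) +
        B ^ m * (∫ t in R..T, h t * (1 - t / T) ^ p) + (C / B) ^ p / (β * p) :=
    fun B R T hB haR hRT => (hcut T (haR.trans hRT)).trans
      (critical_split hpm hβ hB hC.le (ha0.trans_le haR) hRT hfc
        (hfi T (ha0.trans_le (haR.trans hRT))))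
  obtain ⟨M, hM⟩ : ∃ M, ∀ S, a ≤ S → ∫ t in a..S, h t ≤ M := by
    refine ⟨2 ^ p * (2 * (C * (∫ t in (0 : ℝ)..a, |f t|) + (C / (1 / 2)) ^ p / (β * p))),
      fun S haS => ?_⟩
    have hS : 0 < S := ha0.trans_le haS
    set T := 2 * S with hT
    have hT0 : 0 < T := by positivity
    have haT : a ≤ T := by linarith
    have h1 := hsplit (1 / 2) a T (by norm_num) le_rfl haT
    have h2 := (hφ T hT0 a ha0.le haT).1
    have h3 : ((1 : ℝ) / 2) ^ m ≤ 1 / 2 := by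
      simpa using rpow_le_rpow_of_exponent_ge (by norm_num : (0 : ℝ) < 1 / 2) (by norm_num) hm1.le
    have h4 := mul_le_mul_of_nonneg_right h3 (hX0 a T ha0 haT)
    have h5 : T ^ (-β) ≤ 1 := rpow_le_one_of_one_le_of_nonpos (by linarith) (by linarith)
    have h6 : C * T ^ (-β) * (∫ t in (0 : ℝ)..a, |f t|) ≤ C * (∫ t in (0 : ℝ)..a, |f t|) := by
      have := hI0 a ha0
      gcongr
      exact mul_le_of_le_one_right hC.le h5
    have h7 : (∫ t in a..T, h t * (1 - t / T) ^ p) ≤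
        2 * (C * (∫ t in (0 : ℝ)..a, |f t|) + (C / (1 / 2)) ^ p / (β * p)) := by
      have := mul_nonneg hδ.le h2
      linarith
    have h8 : ∫ t in a..S, h t * (1 - t / T) ^ p ≤ ∫ t in a..T, h t * (1 - t / T) ^ p := by
      have hadd := intervalIntegral.integral_add_adjacent_intervals
        (hhφi T a S ha0 haS) (hhφi T S T hS (by linarith))
      have := hX0 S T hS (by linarith)
      linarith
    have h9 : ∫ t in a..S, h t ≤ ∫ t in a..S, 2 ^ p * (h t * (1 - t / T) ^ p) := by
      refine intervalIntegral.integral_mono_on haS (hhi a S ha0 haS)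
        ((hhφi T a S ha0 haS).const_mul _) fun t ht => ?_
      have ht0 : 0 < t := ha0.trans_le ht.1
      have h10 : t / T ≤ 1 / 2 := by
        rw [div_le_iff₀ hT0]; linarith [ht.2]
      have h11 : 1 ≤ 2 ^ p * (1 - t / T) ^ p := by
        rw [← mul_rpow (by norm_num) (by linarith)]
        exact one_le_rpow (by linarith) hp0.le
      calc h t ≤ h t * (2 ^ p * (1 - t / T) ^ p) := le_mul_of_one_le_right (hh0 t ht0) h11
        _ = _ := by ring
    rw [intervalIntegral.integral_const_mul] at h9
    refine h9.trans ?_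
    gcongr
    exact h8.trans h7
  obtain ⟨B, hB, hBC⟩ : ∃ B, 0 < B ∧ (C / B) ^ p / (β * p) = δ / 8 := by
    have hq : 0 < δ / 8 * (β * p) := by positivity
    refine ⟨C / (δ / 8 * (β * p)) ^ (1 / p), by positivity, ?_⟩
    rw [div_div_cancel₀ hC.ne', ← rpow_mul hq.le, one_div_mul_cancel hp0.ne', rpow_one]
    field_simp
  have hBm : 0 < B ^ m := rpow_pos_of_pos hB _
  obtain ⟨R, haR, hR⟩ : ∃ R, a ≤ R ∧ ∀ T, R ≤ T → ∫ t in R..T, h t ≤ δ / (8 * B ^ m) := by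
    have hne : ((fun S => ∫ t in a..S, h t) '' Ici a).Nonempty := ⟨_, a, self_mem_Ici, rfl⟩
    have hbdd : BddAbove ((fun S => ∫ t in a..S, h t) '' Ici a) := by
      refine ⟨M, ?_⟩
      rintro _ ⟨S, hS, rfl⟩
      exact hM S hS
    obtain ⟨_, ⟨R, haR, rfl⟩, hR⟩ := exists_lt_of_lt_csSup hne
      (sub_lt_self (sSup ((fun S => ∫ t in a..S, h t) '' Ici a))
        (by positivity : 0 < δ / (8 * B ^ m)))
    have haR' : a ≤ R := haR
    refine ⟨R, haR', fun T hRT => ?_⟩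
    have h1 : ∫ t in a..T, h t ≤ sSup ((fun S => ∫ t in a..S, h t) '' Ici a) :=
      le_csSup hbdd ⟨T, haR'.trans hRT, rfl⟩
    have h2 := intervalIntegral.integral_add_adjacent_intervals (hhi a R ha0 haR')
      (hhi R T (ha0.trans_le haR') hRT)
    have hR' : sSup ((fun S => ∫ t in a..S, h t) '' Ici a) - δ / (8 * B ^ m) <
      ∫ t in a..R, h t := hR
    linarith
  have hlim1 : Tendsto (fun T : ℝ => δ * (1 - a / T) ^ p) atTop (𝓝 δ) := by
    have h1 : Tendsto (fun T : ℝ => 1 - a / T) atTop (𝓝 1) := by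
      simpa using (tendsto_const_nhds (x := (1 : ℝ))).sub (tendsto_id.const_div_atTop a)
    simpa using (h1.rpow_const (p := p) (Or.inl one_ne_zero)).const_mul δ
  have hlim2 : Tendsto (fun T : ℝ => C * T ^ (-β) * (∫ t in (0 : ℝ)..R, |f t|)) atTop (𝓝 0) := by
    simpa using ((tendsto_rpow_neg_atTop hβ).const_mul C).mul_const (∫ t in (0 : ℝ)..R, |f t|)
  obtain ⟨T, h1, h2, hRT⟩ := ((hlim1.eventually_const_lt (half_lt_self hδ)).and
    ((hlim2.eventually_lt_const (by positivity : 0 < δ / 8)).and (eventually_ge_atTop R))).exists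
  have hR0 : 0 < R := ha0.trans_le haR
  have h3 := hsplit B R T hB haR hRT
  have h4 : ∫ t in R..T, h t * (1 - t / T) ^ p ≤ ∫ t in R..T, h t :=
    intervalIntegral.integral_mono_on hRT (hhφi T R T hR0 hRT) (hhi R T hR0 hRT) fun t ht =>
      mul_le_of_le_one_right (hh0 t (hR0.trans_le ht.1))
        (hφ T (hR0.trans_le hRT) t (hR0.le.trans ht.1) ht.2).2
  have h5 : B ^ m * (∫ t in R..T, h t * (1 - t / T) ^ p) ≤ δ / 8 := by
    calc _ ≤ B ^ m * (δ / (8 * B ^ m)) := by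
          gcongr
          exact h4.trans (hR T hRT)
      _ = _ := by field_simp
  have h6 := hX0 a T ha0 (haR.trans hRT)
  rw [hBC] at h3
  linarith

theorem stmt_10 (α β γ m b : ℝ)
    (hβ0 : 0 < β) (hβα : β < α) (hα1 : α < 1) (hγ : -β < γ)
    (hm1 : 1 < m) (hm2 : m ≤ (γ + 1) / (1 - β)) (hb : 0 ≤ b)
    (y : ℝ → ℝ)
    -- y belongs to the space C_{1-α}^α : y ∈ C_{1-α} and D_0^α y ∈ C_{1-α}
    (hy : MemCw α y) (hDy : MemCw α (RLD α y))
    -- the fractional derivatives of orders α and β exist for t > 0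
    (hdiffα : ∀ t > (0 : ℝ), DifferentiableAt ℝ (RLI (1 - α) y) t)
    (hdiffβ : ∀ t > (0 : ℝ), DifferentiableAt ℝ (RLI (1 - β) y) t)
    -- initial condition I_0^{1-α} y(t)|_{t=0} = b
    (hinit : Tendsto (RLI (1 - α) y) (nhdsWithin 0 (Set.Ioi 0)) (nhds b))
    -- the differential inequality
    (hineq : ∀ t > (0 : ℝ), t ^ γ * |y t| ^ m ≤ RLD α y t + RLD β y t) :
    ∀ t > (0 : ℝ), y t = 0 := by
  have hα0 : 0 < α := hβ0.trans hβα
  have hβ1 : β < 1 := hβα.trans hα1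
  have hyc := hy.continuousOn
  have hdiff : ∀ t > (0 : ℝ), DifferentiableAt ℝ (fun s => RLI (1 - α) y s + RLI (1 - β) y s) t :=
    fun t ht => (hdiffα t ht).add (hdiffβ t ht)
  have hderiv : ∀ t > (0 : ℝ), t ^ γ * |y t| ^ m ≤
      deriv (fun s => RLI (1 - α) y s + RLI (1 - β) y s) t := fun t ht => by
    rw [deriv_fun_add (hdiffα t ht) (hdiffβ t ht)]
    exact hineq t ht
  have hlim : Tendsto (fun s => RLI (1 - α) y s + RLI (1 - β) y s) (𝓝[>] 0) (𝓝 (b + 0)) :=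
    hinit.add (hy.tendsto_RLI_zero hα0 hα1 (by linarith) (by linarith) (by linarith))
  set F : ℝ → ℝ := fun s => RLI (1 - α) y s + RLI (1 - β) y s with hFdef
  have hFc : ContinuousOn F (Ioi 0) := fun t ht => (hdiff t ht).continuousAt.continuousWithinAt
  have hmono : MonotoneOn F (Ioi 0) := by
    refine monotoneOn_of_deriv_nonneg (convex_Ioi 0) hFc ?_ ?_
    · exact fun t ht => (hdiff t (interior_subset ht)).differentiableWithinAt
    · intro t ht
      have ht0 : (0 : ℝ) < t := interior_subset ht
      exact (mul_nonneg (rpow_nonneg ht0.le _) (rpow_nonneg (abs_nonneg _) _)).trans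
        (hderiv t ht0)
  have hF0 : ∀ t > 0, 0 ≤ F t := by
    intro t ht
    have hle : b + 0 ≤ F t := by
      refine le_of_tendsto hlim ?_
      filter_upwards [Ioo_mem_nhdsGT ht] with s hs
      exact hmono hs.1 ht hs.2.le
    linarith
  intro t₀ ht₀
  have ht₀' : (0 : ℝ) < t₀ := ht₀
  by_contra hne
  have hpos : 0 < deriv F t₀ := by
    refine lt_of_lt_of_le ?_ (hderiv t₀ ht₀)
    have := rpow_pos_of_pos (abs_pos.2 hne) m
    have := rpow_pos_of_pos ht₀' γ
    positivity
  have ha1 : 1 ≤ t₀ + 1 := by linarith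
  have hδ : 0 < F (t₀ + 1) := by
    refine lt_of_le_of_ne (hF0 _ (by positivity)) fun h0 => hpos.ne' ?_
    have hev : F =ᶠ[𝓝 t₀] fun _ => 0 := by
      filter_upwards [Ioo_mem_nhds ht₀' (lt_add_one t₀)] with s hs
      refine le_antisymm ?_ (hF0 s hs.1)
      rw [h0]
      exact hmono hs.1 (by simp only [mem_Ioi]; positivity) hs.2.le
    rw [hev.deriv_eq, deriv_const]
  set a := t₀ + 1
  have ha0 : 0 < a := by linarith
  have hpm : m.HolderConjugate (m.conjExponent) := Real.HolderConjugate.conjExponent hm1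
  have hcrit : m * (1 - β) - 1 ≤ γ := by
    rw [le_div_iff₀ (by linarith)] at hm2
    linarith
  set h : ℝ → ℝ := fun t => t ^ (m * (1 - β) - 1) * |y t| ^ m with hh
  have hhc : ContinuousOn h (Ioi 0) :=
    (continuousOn_id.rpow_const fun t ht => Or.inl (ne_of_gt ht)).mul
      (hyc.abs.rpow_const fun t _ => Or.inr (by linarith))
  have hh0 : ∀ t > 0, 0 ≤ h t := fun t ht =>
    mul_nonneg (rpow_nonneg (le_of_lt ht) _) (rpow_nonneg (abs_nonneg _) _)
  have hlow : ∀ s, a ≤ s → F a + ∫ t in a..s, h t ≤ F s := by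
    intro s has
    have hHd : ∀ t, a ≤ t → HasDerivAt (fun s => ∫ t in a..s, h t) (h t) t := by
      intro t hat
      have ht : 0 < t := ha0.trans_le hat
      refine intervalIntegral.integral_hasDerivAt_right ?_ ?_ ?_
      · refine (hhc.mono fun x hx => ?_).intervalIntegrable
        rw [uIcc_of_le hat] at hx
        exact ha0.trans_le hx.1
      · exact hhc.stronglyMeasurableAtFilter isOpen_Ioi t ht
      · exact hhc.continuousAt (Ioi_mem_nhds ht)
    have hFd : ∀ t, a ≤ t →
        HasDerivAt (fun s => F s - ∫ t in a..s, h t) (deriv F t - h t) t := fun t hat =>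
      (hdiff t (ha0.trans_le hat)).hasDerivAt.sub (hHd t hat)
    have hm : MonotoneOn (fun s => F s - ∫ t in a..s, h t) (Ici a) := by
      refine monotoneOn_of_deriv_nonneg (convex_Ici a)
        (fun t ht => (hFd t ht).continuousAt.continuousWithinAt)
        (fun t ht => (hFd t (interior_subset ht)).differentiableAt.differentiableWithinAt)
        fun t ht => ?_
      have hat : a ≤ t := interior_subset ht
      rw [(hFd t hat).deriv]
      refine sub_nonneg.2 (le_trans ?_ (hderiv t (ha0.trans_le hat)))
      exact mul_le_mul_of_nonneg_right (rpow_le_rpow_of_exponent_le (ha1.trans hat) hcrit)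
        (rpow_nonneg (abs_nonneg _) _)
    have := hm (self_mem_Ici) has has
    simp only [intervalIntegral.integral_same, sub_zero] at this
    linarith
  have hGα := Real.Gamma_pos_of_pos (by linarith : 0 < 1 - α)
  have hGβ := Real.Gamma_pos_of_pos (by linarith : 0 < 1 - β)
  have hα' : 0 < 1 - α := by linarith
  have hβ' : 0 < 1 - β := by linarith
  have hp0 := hpm.symm.pos
  refine not_cutoff_inequality (C := m.conjExponent / (Real.Gamma (1 - α) * (1 - α)) +
    m.conjExponent / (Real.Gamma (1 - β) * (1 - β))) hpm hβ0 (by positivity) ha1 hδ hyc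
    (fun T hT => hy.intervalIntegrable hα0 hT) fun T haT => ?_
  exact cutoff_inequality hβα.le hα1 hpm.symm.lt.le ha1 haT hδ.le
    (hy.intervalIntegrable hα0 (ha0.trans_le haT))
    (fun t ht => (hdiffα t ht).continuousAt.continuousWithinAt) hhc hh0 hlow
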